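/- (|+⟩-preparation gadget) Let x be a real number with 0 < x ≤ π/4, set t = tan x, y = arctan( t(√2 + t) / (1 + √2·t) ), A = [[sin y, cos y], [cos y, −sin y]], and v = (cos x, sin x) ∈ ℂ². Let u ∈ ℂ² be the vector of the first two components of the 4-vector G(A,H)·(v ⊗ v), i.e. u = (⟨0| ⊗ I₂)·G(A,H)·(v ⊗ v). Then u = (sin(2x)/√2)·(1, 1); in particular, measuring the first qubit of G(A,H)(v⊗v) in the computational basis yields outcome 0 with probability ‖u‖² = sin²(2x), and conditioned on that outcome the second qubit is left in the state |+⟩ = (1/√2)·(1, 1). -/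

import Mathlib

open Matrix BigOperators

noncomputable section

/-- Pauli X matrix. -/
def PX : Matrix (Fin 2) (Fin 2) ℂ := !![0, 1; 1, 0]
/-- Pauli Y matrix. -/
def PY : Matrix (Fin 2) (Fin 2) ℂ := !![0, -Complex.I; Complex.I, 0]
/-- Pauli Z matrix. -/
def PZ : Matrix (Fin 2) (Fin 2) ℂ := !![1, 0; 0, -1]

/-- The two-qubit operator `G(A,B)` acting as `A` on the even-parity subspace
`span{|00⟩,|11⟩}` and as `B` on the odd-parity subspace `span{|01⟩,|10⟩}`,
with basis ordered `|00⟩, |01⟩, |10⟩, |11⟩`. -/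
def G (A B : Matrix (Fin 2) (Fin 2) ℂ) : Matrix (Fin 4) (Fin 4) ℂ :=
  !![A 0 0, 0,     0,     A 0 1;
     0,     B 0 0, B 0 1, 0;
     0,     B 1 0, B 1 1, 0;
     A 1 0, 0,     0,     A 1 1]

/-- Kronecker product of two vectors in `ℂ²`, giving a vector in `ℂ⁴` with
components ordered `|00⟩, |01⟩, |10⟩, |11⟩`. -/
def kron2 (u v : Fin 2 → ℂ) : Fin 4 → ℂ :=
  ![u 0 * v 0, u 0 * v 1, u 1 * v 0, u 1 * v 1]

/-- The Hadamard matrix `H = (1/√2)·[[1,1],[1,−1]]`. -/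
def Had : Matrix (Fin 2) (Fin 2) ℂ :=
  ((Real.sqrt 2 : ℂ))⁻¹ • !![1, 1; 1, -1]

/-- If `a² + b² = r²` with `b, r > 0`, then `arctan (a / b)` has sine `a / r` and cosine `b / r`. -/
theorem sin_cos_arctan_div {a b r : ℝ} (hb : 0 < b) (hr : 0 < r) (h : a ^ 2 + b ^ 2 = r ^ 2) :
    Real.sin (Real.arctan (a / b)) = a / r ∧ Real.cos (Real.arctan (a / b)) = b / r := by
  have hsqrt : Real.sqrt (1 + (a / b) ^ 2) = r / b := by
    rw [Real.sqrt_eq_iff_mul_self_eq (by positivity) (by positivity)]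
    field_simp
    linarith
  rw [Real.sin_arctan, Real.cos_arctan, hsqrt]
  constructor <;> field_simp

/-- The even-parity amplitude of the gadget, in units of `cos x ^ 2`. -/
theorem sin_add_sq_mul_cos_arctan {t : ℝ} (ht : 0 < t) :
    Real.sin (Real.arctan (t * (Real.sqrt 2 + t) / (1 + Real.sqrt 2 * t))) +
      t ^ 2 * Real.cos (Real.arctan (t * (Real.sqrt 2 + t) / (1 + Real.sqrt 2 * t))) =
      Real.sqrt 2 * t := by
  have h2 : Real.sqrt 2 ^ 2 = 2 := Real.sq_sqrt (by norm_num)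
  have hr : 0 < 1 + Real.sqrt 2 * t + t ^ 2 := by positivity
  obtain ⟨hs, hc⟩ := sin_cos_arctan_div (a := t * (Real.sqrt 2 + t)) (b := 1 + Real.sqrt 2 * t)
    (by positivity) hr (by linear_combination t ^ 2 * h2)
  rw [hs, hc]
  field_simp
  linear_combination (-t) * h2

/-- |+⟩-preparation gadget: for `0 < x ≤ π/4`, with `t = tan x`,
`y = arctan(t(√2+t)/(1+√2 t))`, `A = [[sin y, cos y],[cos y, −sin y]]`, and
`v = (cos x, sin x)`, the vector `u` of the first two components of `G(A,H)·(v⊗v)`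
satisfies `u = (sin(2x)/√2)·(1,1)`; in particular, measuring the first qubit in the
computational basis yields outcome 0 with probability `‖u‖² = sin²(2x)`, and
conditioned on that outcome the second qubit is left in `|+⟩ = (1/√2)·(1,1)`. -/
theorem plus_preparation_gadget (x : ℝ) (hx0 : 0 < x) (hx : x ≤ Real.pi / 4) :
    let t : ℝ := Real.tan x
    let y : ℝ := Real.arctan (t * (Real.sqrt 2 + t) / (1 + Real.sqrt 2 * t))
    let A : Matrix (Fin 2) (Fin 2) ℂ :=
      !![(Real.sin y : ℂ), (Real.cos y : ℂ); (Real.cos y : ℂ), -(Real.sin y : ℂ)]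
    let v : Fin 2 → ℂ := ![(Real.cos x : ℂ), (Real.sin x : ℂ)]
    let w : Fin 4 → ℂ := G A Had *ᵥ kron2 v v
    let u : Fin 2 → ℂ := ![w 0, w 1]
    u = ![((Real.sin (2 * x) / Real.sqrt 2 : ℝ) : ℂ),
          ((Real.sin (2 * x) / Real.sqrt 2 : ℝ) : ℂ)] ∧
    Complex.normSq (u 0) + Complex.normSq (u 1) = Real.sin (2 * x) ^ 2 := by
  intro t y A v w u
  have hcos : 0 < Real.cos x :=
    Real.cos_pos_of_mem_Ioo ⟨by linarith [Real.pi_pos], by linarith [Real.pi_pos]⟩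
  have ht : 0 < t := Real.tan_pos_of_pos_of_lt_pi_div_two hx0 (by linarith [Real.pi_pos])
  have hsin : Real.sin x = t * Real.cos x := (Real.tan_mul_cos hcos.ne').symm
  have h2 : Real.sqrt 2 ^ 2 = 2 := Real.sq_sqrt (by norm_num)
  have hne : Real.sqrt 2 ≠ 0 := by positivity
  have hy : Real.sin y + t ^ 2 * Real.cos y = Real.sqrt 2 * t := sin_add_sq_mul_cos_arctan ht
  have even : Real.sin y * (Real.cos x * Real.cos x) + Real.cos y * (Real.sin x * Real.sin x) =
      Real.sin (2 * x) / Real.sqrt 2 := by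
    rw [Real.sin_two_mul, eq_div_iff hne, hsin]
    linear_combination Real.cos x ^ 2 * Real.sqrt 2 * hy + Real.cos x ^ 2 * t * h2
  have odd : (Real.sqrt 2)⁻¹ * (Real.cos x * Real.sin x) +
      (Real.sqrt 2)⁻¹ * (Real.sin x * Real.cos x) = Real.sin (2 * x) / Real.sqrt 2 := by
    rw [Real.sin_two_mul]
    ring
  have hw0 : w 0 = ((Real.sin (2 * x) / Real.sqrt 2 : ℝ) : ℂ) := by
    rw [← even]
    simp [w, G, A, v, kron2]
    ring
  have hw1 : w 1 = ((Real.sin (2 * x) / Real.sqrt 2 : ℝ) : ℂ) := by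
    rw [← odd]
    simp [w, G, Had, v, kron2]
    ring
  have hu : u = ![((Real.sin (2 * x) / Real.sqrt 2 : ℝ) : ℂ),
      ((Real.sin (2 * x) / Real.sqrt 2 : ℝ) : ℂ)] := by
    simp only [u, hw0, hw1]
  refine ⟨hu, ?_⟩
  rw [hu]
  simp only [Matrix.cons_val_zero, Matrix.cons_val_one, Complex.normSq_ofReal]
  field_simp
  linear_combination (-Real.sin (2 * x) ^ 2) * h2
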